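/- Let σ : K → K be the ring homomorphism with σ(q) = q⁻¹ and let bar : K[x] → K[x] be the induced ring homomorphism with bar(c) = σ(c) for c ∈ K and bar(x) = −q·x. Then for all k ∈ ℕ: bar(B_q(k)) = (−1)^k · q^{C(k+1,2)} · (B_q(k) composed with (q^{k−1}·x + [k−1]_q)), where C(k+1,2) = k(k+1)/2. (In the notation of the shift operator S, this says bar(B_q(k)) = (−1)^k q^{C(k+1,2)} S^{k−1} B_q(k).) -/

import Mathlib

open Polynomial

noncomputable section

/-- `K = ℚ(q)`, the field of rational functions in `q` over `ℚ`. -/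
abbrev K : Type := RatFunc ℚ

/-- The variable `q ∈ K`. -/
def qq : K := RatFunc.X

/-- The quantum integer `[n]_q = (q^n - 1)/(q - 1) ∈ K`. -/
def qInt (n : ℤ) : K := (qq ^ n - 1) / (qq - 1)

/-- The quantum factorial `[n]_q! = ∏_{i=1}^n [i]_q`. -/
def qFact (n : ℕ) : K := ∏ i ∈ Finset.range n, qInt ((i : ℤ) + 1)

/-- The `q`-binomial coefficient polynomial `B_q(k) ∈ K[x]`, with `B_q(0) = 1`. -/
def Bq (k : ℕ) : K[X] :=
  C ((qq ^ (k.choose 2) * qFact k)⁻¹) * ∏ i ∈ Finset.range k, (X - C (qInt i))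

/-- The bar involution on `K[x]` induced by `σ : K → K` with `σ(q) = q⁻¹`: it applies `σ`
to coefficients and sends `x ↦ −q·x`. -/
def barMap (σ : K →+* K) : K[X] →+* K[X] :=
  eval₂RingHom (Polynomial.C.comp σ) (-(C qq * X))

theorem qq_ne_zero : qq ≠ 0 := RatFunc.X_ne_zero

theorem qq_sub_one_ne_zero : qq - 1 ≠ 0 := by
  intro h
  have h1 : (RatFunc.X : RatFunc ℚ) = 1 := sub_eq_zero.mp h
  rw [← RatFunc.algebraMap_X, ← map_one (algebraMap ℚ[X] (RatFunc ℚ))] at h1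
  have h2 := RatFunc.algebraMap_injective ℚ h1
  have h3 := congrArg (Polynomial.eval 0) h2
  simp at h3

theorem sigma_qInt (σ : K →+* K) (hσ : σ qq = qq⁻¹) (n : ℕ) :
    σ (qInt n) = qq * (qq ^ n)⁻¹ * qInt n := by
  have h0 := qq_ne_zero
  have h1 := qq_sub_one_ne_zero
  have h2 : qq⁻¹ - 1 ≠ 0 := by
    intro h
    apply h1
    have : qq * (qq⁻¹ - 1) = 0 := by rw [h, mul_zero]
    rw [mul_sub, mul_inv_cancel₀ h0] at this
    linear_combination -this
  have h3 : 1 - qq ≠ 0 := by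
    intro h
    apply h1
    linear_combination -h
  simp only [qInt, zpow_natCast, map_div₀, map_sub, map_pow, map_one, hσ, inv_pow]
  rw [div_eq_iff h2]
  field_simp
  ring

theorem sigma_qFact (σ : K →+* K) (hσ : σ qq = qq⁻¹) (n : ℕ) :
    qq ^ (n.choose 2) * σ (qFact n) = qFact n := by
  have h0 := qq_ne_zero
  induction n with
  | zero => simp [qFact]
  | succ n ih =>
    have e : qFact (n + 1) = qFact n * qInt ((n + 1 : ℕ) : ℤ) := by
      simp [qFact, Finset.prod_range_succ]
    have e2 : (n + 1).choose 2 = n + n.choose 2 := by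
      rw [Nat.choose_succ_succ' n 1, Nat.choose_one_right]
    rw [e, map_mul, sigma_qInt σ hσ, e2]
    nth_rw 2 [← ih]
    field_simp
    ring

theorem qInt_sub (m i : ℕ) (h : i ≤ m) :
    qInt m - qInt ((m - i : ℕ) : ℤ) = qq ^ (m - i) * qInt i := by
  obtain ⟨j, rfl⟩ := Nat.exists_eq_add_of_le h
  have h1 := qq_sub_one_ne_zero
  simp only [qInt, zpow_natCast, Nat.add_sub_cancel_left]
  field_simp
  ring

theorem factor_eq (σ : K →+* K) (hσ : σ qq = qq⁻¹) (m i : ℕ) (h : i ≤ m) :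
    C (qq ^ m) * (-(C qq * X) - C (σ (qInt i))) =
      C (-qq) * (C (qq ^ m) * X + C (qInt m) - C (qInt ((m - i : ℕ) : ℤ))) := by
  have h0 := qq_ne_zero
  rw [add_sub_assoc, ← C_sub, qInt_sub m i h, sigma_qInt σ hσ]
  have e : qq ^ m * (qq * (qq ^ i)⁻¹ * qInt i) = qq * (qq ^ (m - i) * qInt i) := by
    rw [pow_sub₀ _ h0 h]; ring
  have heq := congrArg (C : K → K[X]) e
  rw [C_mul, C_mul (a := qq)] at heq
  rw [C_neg]
  linear_combination -heq

/-- `bar(B_q(k)) = (−1)^k · q^{C(k+1,2)} · S^{k−1} B_q(k)`, where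
`S^{k−1} B_q(k) = B_q(k)∘(q^{k−1}·x + [k−1]_q)`. -/
theorem bar_qbinomial (σ : K →+* K) (hσ : σ qq = qq⁻¹) (k : ℕ) :
    barMap σ (Bq k) =
      C ((-1) ^ k * qq ^ ((k + 1).choose 2)) *
        (Bq k).comp (C (qq ^ (k - 1)) * X + C (qInt ((k - 1 : ℕ) : ℤ))) := by
  have h0 := qq_ne_zero
  obtain _ | m := k
  · simp [Bq, qFact]
  have hs := sigma_qFact σ hσ (m + 1)
  have hprod : C (qq ^ (m * (m + 1))) * ∏ i ∈ Finset.range (m + 1),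
      (-(C qq * X) - C (σ (qInt i))) = C ((-qq) ^ (m + 1)) *
      ∏ i ∈ Finset.range (m + 1),
        (C (qq ^ m) * X + C (qInt m) - C (qInt (i : ℤ))) := by
    rw [← Finset.prod_range_reflect
      (fun i : ℕ => C (qq ^ m) * X + C (qInt m) - C (qInt (i : ℤ)))]
    rw [pow_mul, C_pow (a := qq ^ m), C_pow (a := -qq)]
    have hc : ∀ a : K[X], a ^ (m + 1) = ∏ _i ∈ Finset.range (m + 1), a := by
      intro a; simp
    rw [hc, hc, ← Finset.prod_mul_distrib, ← Finset.prod_mul_distrib]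
    refine Finset.prod_congr rfl fun i hi => ?_
    rw [factor_eq σ hσ m i (by simpa [Nat.lt_succ_iff] using hi)]
    simp
  have hl : barMap σ (Bq (m + 1)) = C (σ ((qq ^ ((m + 1).choose 2) * qFact (m + 1))⁻¹)) *
      ∏ i ∈ Finset.range (m + 1), (-(C qq * X) - C (σ (qInt i))) := by
    simp [barMap, Bq, eval₂_finsetProd, eval₂_mul]
  have hr : (Bq (m + 1)).comp (C (qq ^ m) * X + C (qInt (m : ℤ))) =
      C ((qq ^ ((m + 1).choose 2) * qFact (m + 1))⁻¹) * ∏ i ∈ Finset.range (m + 1),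
        (C (qq ^ m) * X + C (qInt m) - C (qInt (i : ℤ))) := by
    simp only [Bq, mul_comp, prod_comp, sub_comp, X_comp, C_comp]
  rw [hl, Nat.add_sub_cancel, hr]
  have hne : (C (qq ^ (m * (m + 1))) : K[X]) ≠ 0 := by
    rw [Ne, C_eq_zero]; exact pow_ne_zero _ h0
  apply mul_left_cancel₀ hne
  rw [mul_left_comm, hprod]
  rw [← mul_assoc, ← mul_assoc, ← mul_assoc, ← C_mul, ← C_mul, ← C_mul]
  congr 2
  have c1 : m * (m + 1) = 2 * (m + 1).choose 2 := by
    rw [Nat.choose_two_right, Nat.add_sub_cancel, mul_comm m,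
      Nat.mul_div_cancel' (Nat.even_mul_succ_self m |>.two_dvd.trans (by rw [mul_comm]))]
  have c2 : (m + 1 + 1).choose 2 = (m + 1) + (m + 1).choose 2 := by
    rw [Nat.choose_succ_succ' (m + 1) 1, Nat.choose_one_right]
  rw [c1, c2, map_inv₀, map_mul, map_pow, hσ, neg_pow]
  generalize (m + 1).choose 2 = c at *
  have hsig : σ (qFact (m + 1)) = (qq ^ c)⁻¹ * qFact (m + 1) := by
    rw [eq_inv_mul_iff_mul_eq₀ (pow_ne_zero _ h0)]; exact hs
  rw [hsig]
  simp only [mul_inv, inv_inv, inv_pow]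
  field_simp
  ring
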